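/- arXiv:2312.07940 — 2 statements merged into one kernel-verified Lean document; each statement's English description precedes it below -/
import Mathlib

section
/- For every natural number n and every real x, e^{-x^2/2} |H_n(x)| ≤ (2^n n! √π)^{1/2} / π^{1/4}. -/
open Real

/-- The (physicists') Hermite polynomial, via the Rodrigues formula. -/
noncomputable def hermiteH (n : ℕ) (x : ℝ) : ℝ :=
  (-1 : ℝ) ^ n * Real.exp (x ^ 2) * iteratedDeriv n (fun t : ℝ => Real.exp (-t ^ 2)) x

/-- Key comparison step: if `q` is bounded by one, so is `p`. -/
lemma hermite_aux_step (c : ℝ) (hc : 0 < c) (p q : ℝ → ℝ)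
    (hp : ∀ x, HasDerivAt p (-x * p x + c * q x) x)
    (hq : ∀ x, HasDerivAt q (x * q x - c * p x) x)
    (h0 : p 0 * q 0 = 0) (p0 : p 0 ^ 2 ≤ 1) (hq1 : ∀ x, q x ^ 2 ≤ 1)
    (lim : ∃ L, ∀ x, L ≤ x → p x ^ 2 < 1) : ∀ x, 0 ≤ x → p x ^ 2 ≤ 1 := by
  intro x0 hx0
  by_contra hcon
  push Not at hcon
  obtain ⟨L, hL⟩ := lim
  have hpc : Continuous p := continuous_iff_continuousAt.2 fun x => (hp x).continuousAt
  have hqc : Continuous q := continuous_iff_continuousAt.2 fun x => (hq x).continuousAt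
  have hx0L : x0 ≤ L := by
    by_contra h
    push Not at h
    linarith [hL x0 h.le]
  obtain ⟨ξ, hξ, hmax'⟩ := (isCompact_Icc (a := (0:ℝ)) (b := L)).exists_isMaxOn
    ⟨x0, hx0, hx0L⟩ (f := fun x => p x ^ 2) (by fun_prop)
  have hM : 1 < p ξ ^ 2 := lt_of_lt_of_le hcon (hmax' ⟨hx0, hx0L⟩)
  have hmax : ∀ x, 0 ≤ x → p x ^ 2 ≤ p ξ ^ 2 := by
    intro x hx
    rcases le_total x L with h | h
    · exact hmax' ⟨hx, h⟩
    · linarith [hL x h]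
  have hξ0 : 0 < ξ := by
    rcases hξ.1.lt_or_eq with h | h
    · exact h
    · rw [← h] at hM; linarith
  have hpξ : p ξ ≠ 0 := by
    intro h; rw [h] at hM; norm_num at hM
  have hcrit : -ξ * p ξ + c * q ξ = 0 := by
    have hl : IsLocalMax (fun x => p x ^ 2) ξ := by
      filter_upwards [lt_mem_nhds hξ0] with x hx using hmax x hx.le
    have := hl.hasDerivAt_eq_zero ((hp ξ).pow 2)
    have h2 : p ξ * (-ξ * p ξ + c * q ξ) = 0 := by
      norm_num at this
      rcases this with h | h
      · exact absurd h hpξ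
      · rw [← neg_mul] at h; rw [h, mul_zero]
    exact (mul_eq_zero.1 h2).resolve_left hpξ
  have hξc : ξ < c := by
    by_contra h
    push Not at h
    have h1 : ξ ^ 2 * p ξ ^ 2 = c ^ 2 * q ξ ^ 2 := by
      have : ξ * p ξ = c * q ξ := by linarith
      rw [← mul_pow, ← mul_pow, this]
    have h2 : c ^ 2 ≤ ξ ^ 2 := by gcongr
    have h3 := hq1 ξ
    have h4 : 0 < ξ ^ 2 := by positivity
    nlinarith
  have hD : ∀ x, 0 ≤ x → x ≤ ξ → 0 < c ^ 2 - x ^ 2 := by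
    intro x hx hx'
    nlinarith
  set T : ℝ → ℝ := fun x =>
    (c ^ 2 * (p x ^ 2 + q x ^ 2) - 2 * c * x * p x * q x) / (c ^ 2 - x ^ 2) with hT
  set k : ℝ → ℝ := fun x => (-x * p x + c * q x) * (x * q x - c * p x) with hk
  have hTd : ∀ x, 0 ≤ x → x ≤ ξ → HasDerivAt T (2 * c * k x / (c ^ 2 - x ^ 2) ^ 2) x := by
    intro x hx hx'
    have hN : HasDerivAt (fun x => c ^ 2 * (p x ^ 2 + q x ^ 2) - 2 * c * x * p x * q x) _ x :=
      ((((hp x).pow 2).add ((hq x).pow 2)).const_mul (c ^ 2)).sub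
        (((((hasDerivAt_id x).const_mul (2 * c))).mul (hp x)).mul (hq x))
    have hDd : HasDerivAt (fun x : ℝ => c ^ 2 - x ^ 2) _ x := ((hasDerivAt_id x).pow 2).const_sub (c ^ 2)
    refine (hN.div hDd (hD x hx hx').ne').congr_deriv ?_
    congr 1
    simp [hk]
    ring
  have hTp : ∀ x, 0 ≤ x → x ≤ ξ → -x * p x + c * q x = 0 → T x = p x ^ 2 := by
    intro x hx hx' h
    rw [hT]
    simp only
    rw [div_eq_iff (hD x hx hx').ne']
    linear_combination (c * q x - x * p x) * h
  have hTq : ∀ x, 0 ≤ x → x ≤ ξ → x * q x - c * p x = 0 → T x = q x ^ 2 := by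
    intro x hx hx' h
    rw [hT]
    simp only
    rw [div_eq_iff (hD x hx hx').ne']
    linear_combination (x * q x - c * p x) * h
  have hTc : ContinuousOn T (Set.Icc 0 ξ) := fun x hx =>
    (hTd x hx.1 hx.2).continuousAt.continuousWithinAt
  -- strictness near ξ
  have hkd : HasDerivAt k (p ξ ^ 2 * (1 + (c ^ 2 - ξ ^ 2)) * (c ^ 2 - ξ ^ 2) / c) ξ := by
    have h1 := ((((hasDerivAt_id ξ).neg).mul (hp ξ)).add ((hq ξ).const_mul c)).mul
      (((hasDerivAt_id ξ).mul (hq ξ)).sub ((hp ξ).const_mul c))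
    refine h1.congr_deriv ?_
    have hqe : q ξ = ξ * p ξ / c := by
      field_simp; linarith
    simp
    rw [hqe]
    field_simp
    ring
  have hkξ : k ξ = 0 := by simp only [hk]; rw [hcrit, zero_mul]
  have hkpos : 0 < p ξ ^ 2 * (1 + (c ^ 2 - ξ ^ 2)) * (c ^ 2 - ξ ^ 2) / c := by
    have := hD ξ hξ0.le le_rfl
    positivity
  obtain ⟨a, ha, hka⟩ : ∃ a, a < ξ ∧ ∀ x, a < x → x < ξ → k x < 0 := by
    have hs := (hasDerivAt_iff_tendsto_slope.1 hkd).eventually (lt_mem_nhds hkpos)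
    have hs' : ∀ᶠ x in nhdsWithin ξ (Set.Iio ξ), 0 < slope k ξ x :=
      hs.filter_mono (nhdsWithin_mono _ (fun x hx => ne_of_lt hx))
    obtain ⟨a, ha, h⟩ := (mem_nhdsLT_iff_exists_Ioo_subset).1 hs'
    refine ⟨a, ha, fun x h1 h2 => ?_⟩
    have h3 : 0 < slope k ξ x := h ⟨h1, h2⟩
    rw [slope_def_field, hkξ, sub_zero] at h3
    by_contra h4
    push Not at h4
    have := div_nonpos_of_nonneg_of_nonpos h4 (by linarith : x - ξ ≤ 0)
    linarith
  set b := max a 0 with hb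
  have hbξ : b < ξ := max_lt ha hξ0
  have hb0 : 0 ≤ b := le_max_right _ _
  have hanti : StrictAntiOn T (Set.Icc b ξ) := by
    apply strictAntiOn_of_deriv_neg (convex_Icc b ξ)
    · exact hTc.mono (Set.Icc_subset_Icc hb0 le_rfl)
    · intro x hx
      rw [interior_Icc] at hx
      have hx0 : 0 ≤ x := hb0.trans hx.1.le
      rw [(hTd x hx0 hx.2.le).deriv]
      have := hka x (lt_of_le_of_lt (le_max_left _ _) hx.1) hx.2
      have := hD x hx0 hx.2.le
      apply div_neg_of_neg_of_pos _ (by positivity)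
      nlinarith
  have hTb : p ξ ^ 2 < T b := by
    rw [← hTp ξ hξ0.le le_rfl hcrit]
    exact hanti ⟨le_rfl, hbξ.le⟩ ⟨hbξ.le, le_rfl⟩ hbξ
  obtain ⟨ζ, hζ, hζmax⟩ := (isCompact_Icc (a := (0:ℝ)) (b := ξ)).exists_isMaxOn
    ⟨b, hb0, hbξ.le⟩ hTc
  have hTζ : p ξ ^ 2 < T ζ := hTb.trans_le (hζmax ⟨hb0, hbξ.le⟩)
  have hkζ : k ζ = 0 := by
    rcases hζ.1.lt_or_eq with h | h
    · rcases hζ.2.lt_or_eq with h' | h'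
      · have hl : IsLocalMax T ζ := hζmax.isLocalMax (Icc_mem_nhds h h')
        have := hl.hasDerivAt_eq_zero (hTd ζ hζ.1 hζ.2)
        have hDζ := hD ζ hζ.1 hζ.2
        rw [div_eq_zero_iff] at this
        rcases this with h5 | h5
        · exact (mul_eq_zero.1 h5).resolve_left (by positivity)
        · exact absurd h5 (by positivity)
      · rw [h']; exact hkξ
    · rw [← h]
      simp only [hk]
      linear_combination (-c ^ 2) * h0
  rcases mul_eq_zero.1 hkζ with h | h
  · rw [hTp ζ hζ.1 hζ.2 h] at hTζ
    linarith [hmax ζ hζ.1]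
  · rw [hTq ζ hζ.1 hζ.2 h] at hTζ
    linarith [hq1 ζ]

/-- Hermite polynomials by recursion. -/
noncomputable def hermiteAuxP : ℕ → Polynomial ℝ
  | 0 => 1
  | n + 1 => 2 * Polynomial.X * hermiteAuxP n - Polynomial.derivative (hermiteAuxP n)

lemma hermiteAuxP_deriv (n : ℕ) : Polynomial.derivative (hermiteAuxP (n + 1)) =
    2 * ((n : Polynomial ℝ) + 1) * hermiteAuxP n := by
  induction n with
  | zero => simp [hermiteAuxP]
  | succ m ih =>
    have h1 : hermiteAuxP (m + 1 + 1) = 2 * Polynomial.X * hermiteAuxP (m + 1)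
      - 2 * ((m : Polynomial ℝ) + 1) * hermiteAuxP m := by
      rw [← ih]; rfl
    have h2 : hermiteAuxP (m + 1) = 2 * Polynomial.X * hermiteAuxP m
      - Polynomial.derivative (hermiteAuxP m) := rfl
    rw [h1]
    simp only [Polynomial.derivative_sub, Polynomial.derivative_mul, ih, Polynomial.derivative_X,
      Polynomial.derivative_ofNat, Polynomial.derivative_add, Polynomial.derivative_one,
      Polynomial.derivative_natCast]
    push_cast
    linear_combination (-2 * ((m : Polynomial ℝ) + 1)) * h2

lemma hermiteAux_iter (n : ℕ) : iteratedDeriv n (fun t : ℝ => Real.exp (-t ^ 2)) =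
    fun x => (-1) ^ n * (hermiteAuxP n).eval x * Real.exp (-x ^ 2) := by
  induction n with
  | zero => ext x; simp [hermiteAuxP]
  | succ m ih =>
    rw [iteratedDeriv_succ, ih]
    ext x
    have he : HasDerivAt (fun t : ℝ => Real.exp (-t ^ 2)) (Real.exp (-x ^ 2) * (-(2 * x))) x := by
      have := (((hasDerivAt_id x).pow 2).neg).exp
      refine this.congr_deriv ?_
      simp
    have h := (((hermiteAuxP m).hasDerivAt x).const_mul ((-1) ^ m)).mul he
    refine h.deriv.trans ?_
    simp only [hermiteAuxP, Polynomial.eval_sub, Polynomial.eval_mul, Polynomial.eval_ofNat,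
      Polynomial.eval_X]
    ring

lemma hermiteH_eq_aux (n : ℕ) (x : ℝ) : hermiteH n x = (hermiteAuxP n).eval x := by
  rw [hermiteH, hermiteAux_iter]
  simp only
  have h1 : Real.exp (x ^ 2) * Real.exp (-x ^ 2) = 1 := by
    rw [← Real.exp_add]; simp
  have h2 : ((-1 : ℝ) ^ n) * (-1) ^ n = 1 := by
    rw [← mul_pow]; simp
  linear_combination ((-1 : ℝ) ^ n * (-1) ^ n * (hermiteAuxP n).eval x) * h1
    + (hermiteAuxP n).eval x * h2

lemma hermiteAuxP_rec (m : ℕ) : hermiteAuxP (m + 1 + 1) = 2 * Polynomial.X * hermiteAuxP (m + 1)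
      - 2 * ((m : Polynomial ℝ) + 1) * hermiteAuxP m := by
  rw [← hermiteAuxP_deriv]; rfl

lemma hermiteAuxP_rec_eval (m : ℕ) (x : ℝ) : (hermiteAuxP (m + 1 + 1)).eval x =
    2 * x * (hermiteAuxP (m + 1)).eval x - 2 * ((m : ℝ) + 1) * (hermiteAuxP m).eval x := by
  rw [hermiteAuxP_rec]
  simp

lemma hermiteAuxP_neg (n : ℕ) (x : ℝ) : ((hermiteAuxP n).eval (-x)) ^ 2 =
    ((hermiteAuxP n).eval x) ^ 2 := by
  have key : ∀ n : ℕ, (hermiteAuxP n).eval (-x) = (-1) ^ n * (hermiteAuxP n).eval x ∧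
      (hermiteAuxP (n + 1)).eval (-x) = (-1) ^ (n + 1) * (hermiteAuxP (n + 1)).eval x := by
    intro n
    induction n with
    | zero => simp [hermiteAuxP]
    | succ m ih =>
      refine ⟨ih.2, ?_⟩
      rw [hermiteAuxP_rec_eval, hermiteAuxP_rec_eval, ih.1, ih.2]
      ring
  rw [(key n).1, mul_pow, ← pow_mul, mul_comm n 2, pow_mul]
  simp

lemma hermiteAuxP_zero_mul (n : ℕ) :
    (hermiteAuxP (n + 1)).eval 0 * (hermiteAuxP n).eval 0 = 0 := by
  induction n with
  | zero => simp [hermiteAuxP]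
  | succ m ih =>
    rw [hermiteAuxP_rec_eval]
    linear_combination (-2 * ((m : ℝ) + 1)) * ih

lemma hermiteAuxP_zero_sq (n : ℕ) :
    ((hermiteAuxP n).eval 0) ^ 2 ≤ 2 ^ n * n.factorial := by
  have key : ∀ n : ℕ, ((hermiteAuxP n).eval 0) ^ 2 ≤ 2 ^ n * n.factorial ∧
      ((hermiteAuxP (n + 1)).eval 0) ^ 2 ≤ 2 ^ (n + 1) * (n + 1).factorial := by
    intro n
    induction n with
    | zero => simp [hermiteAuxP]
    | succ m ih =>
      refine ⟨ih.2, ?_⟩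
      rw [hermiteAuxP_rec_eval, Nat.factorial_succ, Nat.factorial_succ]
      push_cast
      have h := ih.1
      have hm : (0 : ℝ) ≤ m := m.cast_nonneg
      calc _ = (4 * ((m : ℝ) + 1) ^ 2) * ((hermiteAuxP m).eval 0) ^ 2 := by ring
        _ ≤ (4 * ((m : ℝ) + 1) * ((m : ℝ) + 1 + 1)) * (2 ^ m * m.factorial) := by
          have h5 : 4 * ((m : ℝ) + 1) ^ 2 ≤ 4 * ((m : ℝ) + 1) * ((m : ℝ) + 1 + 1) := by nlinarith
          exact mul_le_mul h5 h (sq_nonneg _) (by positivity)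
        _ = _ := by ring
  exact (key n).1

/-- Normalised Hermite functions (sup norm normalisation). -/
noncomputable def hermiteAuxPhi (n : ℕ) (x : ℝ) : ℝ :=
  Real.exp (-x ^ 2 / 2) * (hermiteAuxP n).eval x / Real.sqrt (2 ^ n * n.factorial)

lemma hermiteAux_exp (x : ℝ) :
    HasDerivAt (fun t : ℝ => Real.exp (-t ^ 2 / 2)) (Real.exp (-x ^ 2 / 2) * (-x)) x := by
  have := ((((hasDerivAt_id x).pow 2).neg).div_const 2).exp
  refine this.congr_deriv ?_
  simp
  ring

lemma hermiteAux_sqrt (n : ℕ) : Real.sqrt (2 ^ (n + 1) * (n + 1).factorial) =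
    Real.sqrt (2 * (n + 1)) * Real.sqrt (2 ^ n * n.factorial) := by
  rw [← Real.sqrt_mul (by positivity)]
  congr 1
  rw [Nat.factorial_succ]
  push_cast
  ring

lemma hermiteAux_lim (n : ℕ) : ∃ L, ∀ x, L ≤ x → hermiteAuxPhi n x ^ 2 < 1 := by
  have h1 : Filter.Tendsto (fun x => (hermiteAuxP n).eval x / Real.exp x) Filter.atTop (nhds 0) :=
    Polynomial.tendsto_div_exp_atTop _
  have h2 : Filter.Tendsto (hermiteAuxPhi n) Filter.atTop (nhds 0) := by
    apply squeeze_zero_norm (a := fun x => |(hermiteAuxP n).eval x / Real.exp x| *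
      (Real.exp (1 / 2) / Real.sqrt (2 ^ n * n.factorial)))
    · intro x
      rw [hermiteAuxPhi, Real.norm_eq_abs, abs_div, abs_mul, abs_div, Real.abs_exp, Real.abs_exp,
        abs_of_nonneg (Real.sqrt_nonneg _)]
      have : Real.exp (-x ^ 2 / 2) ≤ Real.exp (1 / 2) / Real.exp x := by
        rw [← Real.exp_sub]
        apply Real.exp_le_exp.2
        nlinarith [sq_nonneg (x - 1)]
      calc _ ≤ Real.exp (1 / 2) / Real.exp x * |(hermiteAuxP n).eval x| /
            Real.sqrt (2 ^ n * n.factorial) := by gcongr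
        _ = _ := by ring
    · have := h1.abs.mul_const (Real.exp (1 / 2) / Real.sqrt (2 ^ n * n.factorial))
      simpa using this
  have h3 := h2.pow 2
  have h4 := h3.eventually (gt_mem_nhds (by norm_num : (0 : ℝ) ^ 2 < 1))
  exact Filter.eventually_atTop.1 h4

lemma hermiteAuxPhi_le (n : ℕ) : ∀ x, hermiteAuxPhi n x ^ 2 ≤ 1 := by
  induction n with
  | zero =>
    intro x
    have h1 : Real.exp (-x ^ 2 / 2) ≤ 1 := Real.exp_le_one_iff.2 (by nlinarith [sq_nonneg x])
    have h2 := Real.exp_pos (-x ^ 2 / 2)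
    simp only [hermiteAuxPhi, hermiteAuxP]
    simp only [Polynomial.eval_one, pow_zero, Nat.factorial_zero, Nat.cast_one, mul_one,
      Real.sqrt_one, div_one]
    nlinarith
  | succ m ih =>
    have hs : 0 < Real.sqrt (2 ^ m * m.factorial) := by positivity
    have hc : 0 < Real.sqrt (2 * ((m : ℝ) + 1)) := by positivity
    have hc2 : Real.sqrt (2 * ((m : ℝ) + 1)) ^ 2 = 2 * ((m : ℝ) + 1) :=
      Real.sq_sqrt (by positivity)
    have main : ∀ x, 0 ≤ x → hermiteAuxPhi (m + 1) x ^ 2 ≤ 1 := by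
      apply hermite_aux_step (Real.sqrt (2 * (m + 1))) hc _ (hermiteAuxPhi m)
      · intro x
        have h := ((hermiteAux_exp x).mul ((hermiteAuxP (m + 1)).hasDerivAt x)).div_const
          (Real.sqrt (2 ^ (m + 1) * (m + 1).factorial))
        refine h.congr_deriv ?_
        rw [hermiteAuxP_deriv]
        simp only [hermiteAuxPhi, hermiteAux_sqrt, Polynomial.eval_mul, Polynomial.eval_add,
          Polynomial.eval_ofNat, Polynomial.eval_natCast, Polynomial.eval_one]
        field_simp
        rw [hc2]
        ring
      · intro x
        have h := ((hermiteAux_exp x).mul ((hermiteAuxP m).hasDerivAt x)).div_const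
          (Real.sqrt (2 ^ m * m.factorial))
        refine h.congr_deriv ?_
        simp only [hermiteAuxPhi, hermiteAux_sqrt, hermiteAuxP, Polynomial.eval_mul,
          Polynomial.eval_sub, Polynomial.eval_ofNat, Polynomial.eval_X]
        field_simp
        ring
      · simp only [hermiteAuxPhi]
        have := hermiteAuxP_zero_mul m
        rw [div_mul_div_comm, mul_mul_mul_comm, this]
        simp
      · simp only [hermiteAuxPhi]
        rw [div_pow, mul_pow, Real.sq_sqrt (by positivity), div_le_one (by positivity)]
        simpa using hermiteAuxP_zero_sq (m + 1)
      · exact ih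
      · exact hermiteAux_lim _
    intro x
    rcases le_total 0 x with h | h
    · exact main x h
    · have h2 := main (-x) (by linarith)
      simp only [hermiteAuxPhi] at h2 ⊢
      rw [div_pow, mul_pow, hermiteAuxP_neg, neg_sq] at h2
      rwa [div_pow, mul_pow]

theorem hermite_uniform_bound (n : ℕ) (x : ℝ) :
    Real.exp (-x ^ 2 / 2) * |hermiteH n x| ≤
      Real.sqrt (2 ^ n * n.factorial * Real.sqrt π) / π ^ ((1 : ℝ) / 4) := by
  have h1 : Real.sqrt (2 ^ n * n.factorial * Real.sqrt π) / π ^ ((1 : ℝ) / 4) =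
      Real.sqrt (2 ^ n * n.factorial) := by
    have : Real.sqrt (Real.sqrt π) = π ^ ((1 : ℝ) / 4) := by
      rw [Real.sqrt_eq_rpow, Real.sqrt_eq_rpow, ← Real.rpow_mul Real.pi_pos.le]
      norm_num
    rw [Real.sqrt_mul (by positivity), this]
    have : 0 < π ^ ((1 : ℝ) / 4) := Real.rpow_pos_of_pos Real.pi_pos _
    field_simp
  rw [h1, hermiteH_eq_aux]
  have h2 := hermiteAuxPhi_le n x
  rw [sq_le_one_iff_abs_le_one, hermiteAuxPhi, abs_div, abs_mul, Real.abs_exp,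
    abs_of_nonneg (Real.sqrt_nonneg _), div_le_one (by positivity)] at h2
  exact h2
end

section
/- For λ > 0 and z ∈ ℂ with Im(z) < 0, one has ∫_ℝ e^{-iλx}/(z-x) dx = 2πi e^{-iλz}, while for Im(z) > 0 the integral equals 0. -/
open Real Complex Filter intervalIntegral

lemma aux_split (z c p q : ℂ) (E : ℂ → ℂ) (hE : Differentiable ℂ E) (hc : c = E z)
    (h : ∀ x : ℝ, z - (p + x * q) ≠ 0) (a b : ℝ) :
    ∫ x : ℝ in a..b, E (p + x * q) / (z - (p + x * q)) =
      -(∫ x : ℝ in a..b, dslope E z (p + x * q)) + c * ∫ x : ℝ in a..b, 1 / (z - (p + x * q)) := by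
  have hd : Continuous (dslope E z) := by
    have : DifferentiableOn ℂ (dslope E z) Set.univ :=
      (Complex.differentiableOn_dslope Filter.univ_mem).2 hE.differentiableOn
    exact continuousOn_univ.1 this.continuousOn
  have h1 : Continuous fun x : ℝ => dslope E z (p + x * q) := by fun_prop
  have h2 : Continuous fun x : ℝ => 1 / (z - (p + x * q)) :=
    continuous_const.div (by fun_prop) h
  have h3 : Continuous fun x : ℝ => -dslope E z (p + x * q) := h1.neg
  have h4 : Continuous fun x : ℝ => c * (1 / (z - (p + x * q))) := continuous_const.mul h2
  rw [← intervalIntegral.integral_const_mul, ← intervalIntegral.integral_neg,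
    ← intervalIntegral.integral_add (h3.intervalIntegrable _ _)
      (h4.intervalIntegrable _ _)]
  congr 1
  ext x
  have hx := h x
  have hne : p + x * q ≠ z := fun e => hx (by rw [e]; ring)
  rw [dslope_of_ne _ hne, slope_def_field, hc]
  have h3 : p + x * q - z ≠ 0 := sub_ne_zero.2 hne
  rw [show z - (p + x * q) = -(p + x * q - z) by ring]
  field_simp
  ring

lemma aux_log (z p q s : ℂ) (hs : s ≠ 0)
    (h : ∀ x : ℝ, s * (p + x * q - z) ∈ slitPlane) (a b : ℝ) :
    q * ∫ x : ℝ in a..b, 1 / (z - (p + x * q)) =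
      Complex.log (s * (p + a * q - z)) - Complex.log (s * (p + b * q - z)) := by
  have hn : ∀ x : ℝ, z - (p + x * q) ≠ 0 := fun x e => by
    apply slitPlane_ne_zero (h x)
    rw [show p + x * q - z = -(z - (p + x * q)) by ring, e]; simp
  rw [← intervalIntegral.integral_const_mul]
  rw [intervalIntegral.integral_eq_sub_of_hasDerivAt
    (f := fun x : ℝ => -Complex.log (s * (p + x * q - z)))]
  · ring
  · intro x _
    have h1 : HasDerivAt (fun x : ℝ => s * (p + x * q - z)) (s * q) x := by
      have := (((((hasDerivAt_id x).ofReal_comp).mul_const q).const_add p).sub_const z).const_mul s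
      simpa using this
    have h2 := (h1.clog_real (h x)).neg
    refine HasDerivAt.congr_deriv h2 ?_
    have hx := hn x
    have h3 : p + x * q - z ≠ 0 := fun e => hx (by rw [← neg_sub, e, neg_zero])
    rw [show z - (p + x * q) = -(p + x * q - z) by ring]
    field_simp
  · apply Continuous.intervalIntegrable
    exact continuous_const.mul (continuous_const.div (by fun_prop) hn)

lemma aux_rect (F : ℂ → ℂ) (R : ℝ) (hR : 0 ≤ R)
    (H : DifferentiableOn ℂ F {w | w.im ≤ 0}) :
    ∫ x : ℝ in -R..R, F (0 + x * 1) = (∫ x : ℝ in -R..R, F (-R * I + x * 1))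
      + I * (∫ x : ℝ in -R..0, F (R + x * I)) - I * (∫ x : ℝ in -R..0, F (-R + x * I)) := by
  have := Complex.integral_boundary_rect_eq_zero_of_differentiableOn F (-R - R * I) R (by
    apply H.mono
    intro w hw
    have := hw.2
    simp [Set.uIcc_of_le, hR] at this
    exact this.2)
  simp at this
  simp only [mul_one, zero_add, add_comm (-(R : ℂ) * I)]
  simp only [neg_mul]
  linear_combination -this

lemma aux_bound (lam : ℝ) (hlam : 0 < lam) (z : ℂ) :
    Tendsto (fun R : ℝ => 
      (∫ x : ℝ in -R..R, Complex.exp (-(I * lam * (-R * I + x * 1))) / (z - (-R * I + x * 1)))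
      + I * (∫ x : ℝ in -R..0, Complex.exp (-(I * lam * (R + x * I))) / (z - (R + x * I)))
      - I * (∫ x : ℝ in -R..0, Complex.exp (-(I * lam * (-R + x * I))) / (z - (-R + x * I))))
      atTop (nhds 0) := by
  have hb : ∀ (R : ℝ), ‖z‖ < R → ∀ w : ℂ, R ≤ ‖w‖ →
      ‖Complex.exp (-(I * lam * w)) / (z - w)‖ ≤ Real.exp (lam * w.im) / (R - ‖z‖) := by
    intro R hR w hw
    rw [norm_div, Complex.norm_exp]
    have h1 : R - ‖z‖ ≤ ‖z - w‖ := by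
      have := norm_sub_norm_le w z
      rw [norm_sub_rev] at this; linarith
    have h2 : (-(I * lam * w)).re = lam * w.im := by simp
    rw [h2]
    have : 0 < R - ‖z‖ := by linarith
    gcongr
  have hint : ∀ R : ℝ, ∫ x : ℝ in -R..0, Real.exp (lam * x) = (1 - Real.exp (-(lam * R))) / lam := by
    intro R
    rw [intervalIntegral.integral_comp_mul_left (fun x => Real.exp x) hlam.ne', integral_exp]
    simp [div_eq_inv_mul]
  have hside : ∀ R : ℝ, ‖z‖ < R → ∀ s : ℂ, R ≤ |s.re| → s.im = 0 →
      ‖∫ x : ℝ in -R..0, Complex.exp (-(I * lam * (s + x * I))) / (z - (s + x * I))‖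
        ≤ 1 / lam / (R - ‖z‖) := by
    intro R hR s hs hs'
    have hz := norm_nonneg z
    have hpos : 0 < R - ‖z‖ := by linarith
    calc _ ≤ ∫ x : ℝ in -R..0, Real.exp (lam * x) / (R - ‖z‖) := by
          apply intervalIntegral.norm_integral_le_of_norm_le (by linarith)
          · filter_upwards with x _
            have := hb R hR (s + x * I) (hs.trans (by
              simpa using Complex.abs_re_le_norm (s + x * I)))
            simpa [hs'] using this
          · apply Continuous.intervalIntegrable; fun_prop
      _ = (1 - Real.exp (-(lam * R))) / lam / (R - ‖z‖) := by
          rw [intervalIntegral.integral_div, hint]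
      _ ≤ _ := by
          gcongr
          linarith [Real.exp_pos (-(lam * R))]
  have hbot : ∀ R : ℝ, ‖z‖ < R →
      ‖∫ x : ℝ in -R..R, Complex.exp (-(I * lam * (-R * I + x * 1))) / (z - (-R * I + x * 1))‖
        ≤ 2 * (R * Real.exp (-(lam * R))) * (1 / (R - ‖z‖)) := by
    intro R hR
    have hz := norm_nonneg z
    have := intervalIntegral.norm_integral_le_of_norm_le_const (a := -R) (b := R)
      (C := Real.exp (-(lam * R)) / (R - ‖z‖))
      (f := fun x : ℝ => Complex.exp (-(I * lam * (-R * I + x * 1))) / (z - (-R * I + x * 1))) (by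
        intro x _
        have := hb R hR (-R * I + x * 1) (by
          have := Complex.abs_im_le_norm (-R * I + x * 1)
          simp at this
          simpa using (le_abs_self R).trans this)
        simpa using this)
    refine this.trans (le_of_eq ?_)
    rw [abs_of_nonneg (by linarith)]
    ring
  have t0 : Tendsto (fun R : ℝ => 1 / (R - ‖z‖)) atTop (nhds 0) := by
    refine (tendsto_atTop_add_const_right atTop (-‖z‖) tendsto_id).inv_tendsto_atTop.congr ?_
    intro R
    simp [sub_eq_add_neg]
  have t1 : Tendsto (fun R : ℝ => R * Real.exp (-(lam * R))) atTop (nhds 0) := by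
    have := tendsto_pow_mul_exp_neg_atTop_nhds_zero 1
    have h2 := (this.comp (tendsto_id.const_mul_atTop hlam)).const_mul (1 / lam)
    simp only [mul_zero] at h2
    refine h2.congr fun R => ?_
    simp only [Function.comp, id, pow_one]
    field_simp
  have t2 : Tendsto (fun R : ℝ => 2 * (R * Real.exp (-(lam * R))) * (1 / (R - ‖z‖))
      + 1 / lam * (1 / (R - ‖z‖)) + 1 / lam * (1 / (R - ‖z‖))) atTop (nhds 0) := by
    have := (((t1.const_mul 2).mul t0).add (t0.const_mul (1 / lam))).add (t0.const_mul (1 / lam))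
    simpa using this
  refine squeeze_zero_norm' ?_ t2
  filter_upwards [eventually_gt_atTop ‖z‖] with R hR
  have e1 := hside R hR R (by simpa using le_abs_self R) (by simp)
  have e2 := hside R hR (-R) (by simpa using le_abs_self R) (by simp)
  have e0 := hbot R hR
  refine (norm_sub_le _ _).trans (add_le_add ((norm_add_le _ _).trans (add_le_add e0 ?_)) ?_)
  · rw [norm_mul, norm_I, one_mul]; exact e1.trans (le_of_eq (by ring))
  · rw [norm_mul, norm_I, one_mul]; exact e2.trans (le_of_eq (by ring))

lemma log_neg_of_im_pos (a : ℂ) (h : 0 < a.im) :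
    Complex.log (-a) = Complex.log a - Real.pi * I := by
  simp only [Complex.log, norm_neg, Complex.arg_neg_eq_arg_sub_pi_of_im_pos h]
  push_cast
  ring

theorem integral_exp_neg_mul_I_div_sub (lam : ℝ) (hlam : 0 < lam) (z : ℂ) :
    (z.im < 0 →
      Tendsto (fun R : ℝ => ∫ x : ℝ in -R..R, Complex.exp (-(Complex.I * lam * x)) / (z - x))
        atTop (nhds (2 * Real.pi * Complex.I * Complex.exp (-(Complex.I * lam * z))))) ∧
    (z.im > 0 →
      Tendsto (fun R : ℝ => ∫ x : ℝ in -R..R, Complex.exp (-(Complex.I * lam * x)) / (z - x))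
        atTop (nhds 0)) := by
  have key := aux_bound lam hlam z
  constructor
  · intro hz
    have key2 := key.add_const (2 * Real.pi * I * Complex.exp (-(I * lam * z)))
    rw [zero_add] at key2
    refine key2.congr' ?_
    filter_upwards [eventually_gt_atTop ‖z‖] with R hR
    have hz0 := norm_nonneg z
    have hre := abs_lt.1 ((Complex.abs_re_le_norm z).trans_lt hR)
    have him := abs_lt.1 ((Complex.abs_im_le_norm z).trans_lt hR)
    set E : ℂ → ℂ := fun w => Complex.exp (-(I * lam * w)) with hEdef
    have hE : Differentiable ℂ E := by intro w; simp only [hEdef]; fun_prop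
    have nz : ∀ (s w : ℂ), s * (w - z) ∈ slitPlane → z - w ≠ 0 := by
      intro s w h e
      apply slitPlane_ne_zero h
      rw [← neg_sub, e]; simp
    have ht : ∀ x : ℝ, (1 : ℂ) * (0 + x * 1 - z) ∈ slitPlane := fun x =>
      Or.inr (by simpa using hz.ne)
    have hb : ∀ x : ℝ, (-1 : ℂ) * (-R * I + x * 1 - z) ∈ slitPlane := fun x =>
      Or.inr (by simp; intro h; linarith)
    have hr : ∀ x : ℝ, (1 : ℂ) * (R + x * I - z) ∈ slitPlane := fun x =>
      Or.inl (by simp; linarith)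
    have hl : ∀ x : ℝ, (-1 : ℂ) * (-R + x * I - z) ∈ slitPlane := fun x =>
      Or.inl (by simp; linarith)
    have st := aux_split z (E z) 0 1 E hE rfl (fun x => nz _ _ (ht x)) (-R) R
    have sb := aux_split z (E z) (-R * I) 1 E hE rfl (fun x => nz _ _ (hb x)) (-R) R
    have sr := aux_split z (E z) R I E hE rfl (fun x => nz _ _ (hr x)) (-R) 0
    have sl := aux_split z (E z) (-R) I E hE rfl (fun x => nz _ _ (hl x)) (-R) 0
    have lt := aux_log z 0 1 1 one_ne_zero ht (-R) R
    have lb := aux_log z (-R * I) 1 (-1) (by simp) hb (-R) R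
    have lr := aux_log z R I 1 one_ne_zero hr (-R) 0
    have ll := aux_log z (-R) I (-1) (by simp) hl (-R) 0
    have hrect := aux_rect (dslope E z) R (by linarith) (by
      have : DifferentiableOn ℂ (dslope E z) Set.univ :=
        (Complex.differentiableOn_dslope Filter.univ_mem).2 hE.differentiableOn
      exact this.mono (Set.subset_univ _))
    have c1 := log_neg_of_im_pos (-R - z) (by simpa using hz)
    have c2 := log_neg_of_im_pos (-(R - R * I - z)) (by simp; linarith)
    rw [neg_neg] at c2
    have g : ∫ x : ℝ in -R..R, Complex.exp (-(Complex.I * lam * x)) / (z - x)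
      = ∫ x : ℝ in -R..R, E (0 + x * 1) / (z - (0 + x * 1)) := by simp [hEdef]
    rw [g]
    change (∫ x : ℝ in -R..R, E (-R * I + x * 1) / (z - (-R * I + x * 1)))
      + I * (∫ x : ℝ in -R..0, E (R + x * I) / (z - (R + x * I)))
      - I * (∫ x : ℝ in -R..0, E (-R + x * I) / (z - (-R + x * I)))
      + 2 * Real.pi * I * E z = _
    rw [st, sb, sr, sl]
    push_cast at lt lb lr ll
    rw [show (1 : ℂ) * (0 + -R * 1 - z) = -R - z by ring,
      show (1 : ℂ) * (0 + R * 1 - z) = R - z by ring] at lt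
    rw [show (-1 : ℂ) * (-R * I + -R * 1 - z) = R + R * I + z by ring,
      show (-1 : ℂ) * (-R * I + R * 1 - z) = -(R - R * I - z) by ring] at lb
    rw [show (1 : ℂ) * (R + -R * I - z) = R - R * I - z by ring,
      show (1 : ℂ) * (R + 0 * I - z) = R - z by ring] at lr
    rw [show (-1 : ℂ) * (-R + -R * I - z) = R + R * I + z by ring,
      show (-1 : ℂ) * (-R + 0 * I - z) = -(-R - z) by ring] at ll
    linear_combination hrect + E z * (lb + lr - ll - lt + c1 + c2)
  · intro hz
    refine key.congr' ?_
    filter_upwards [eventually_ge_atTop 0] with R hR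
    have := aux_rect (fun w => Complex.exp (-(I * lam * w)) / (z - w)) R hR (by
      intro w hw
      have hw' : z - w ≠ 0 := fun e => by
        have := congrArg Complex.im e
        simp at this hw
        linarith
      apply DifferentiableAt.differentiableWithinAt
      exact DifferentiableAt.div (by fun_prop) (by fun_prop) hw')
    rw [← this]
    simp
end
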